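/- Let K be the transition matrix of an irreducible birth and death chain on {0,1,...,n} with stationary distribution π, and let λ_1,...,λ_n be the non-zero eigenvalues of I − K. Set t = Σ_{i=1}^n 1/λ_i, σ² = Σ_{i=1}^n 1/λ_i², ρ² = σ² − t, and λ = min_{1≤i≤n} λ_i. Then for every 0 ≤ i ≤ n, with a(i) = min{π([0,i]), π([i,n])}: t ≤ E_0 τ̃_i + E_n τ̃_i = E_0 τ_i + E_n τ_i ≤ t + 4/(a(i)λ); σ² ≤ Var_0 τ̃_i + Var_n τ̃_i ≤ 17σ²/a(i)²; and ρ² ≤ Var_0 τ_i + Var_n τ_i ≤ ρ² + 17/(a(i)²λ²). -/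

import Mathlib

open scoped BigOperators
open Filter Matrix Polynomial MeasureTheory

noncomputable section

/-- An irreducible birth and death chain on `{0,1,...,n}`, together with its
(unique) stationary distribution. -/
structure BDChain (n : ℕ) where
  K : Matrix (Fin (n + 1)) (Fin (n + 1)) ℝ
  pi : Fin (n + 1) → ℝ
  K_nonneg : ∀ i j, 0 ≤ K i j
  K_rowSum : ∀ i, ∑ j, K i j = 1
  K_tridiag : ∀ i j : Fin (n + 1), 1 < |(i : ℤ) - (j : ℤ)| → K i j = 0
  K_irred : ∀ i : ℕ, ∀ h : i < n,
    0 < K ⟨i, by omega⟩ ⟨i + 1, by omega⟩ ∧ 0 < K ⟨i + 1, by omega⟩ ⟨i, by omega⟩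
  pi_pos : ∀ i, 0 < pi i
  pi_sum : ∑ i, pi i = 1
  pi_stat : ∀ j, ∑ i, pi i * K i j = pi j

namespace BDChain

variable {n : ℕ}

/-- `π([0,M])` -/
def piLow (c : BDChain n) (M : Fin (n + 1)) : ℝ :=
  ∑ ℓ : Fin (n + 1), if ℓ ≤ M then c.pi ℓ else 0

/-- `π([M,n])` -/
def piHigh (c : BDChain n) (M : Fin (n + 1)) : ℝ :=
  ∑ ℓ : Fin (n + 1), if M ≤ ℓ then c.pi ℓ else 0

/-- `π([a,b])` -/
def piInt (c : BDChain n) (a b : Fin (n + 1)) : ℝ :=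
  ∑ ℓ : Fin (n + 1), if a ≤ ℓ ∧ ℓ ≤ b then c.pi ℓ else 0

/-- The substochastic matrix of the chain killed at state `i`. -/
def killed (c : BDChain n) (i : Fin (n + 1)) : Matrix (Fin (n + 1)) (Fin (n + 1)) ℝ :=
  Matrix.of fun x y => if x = i ∨ y = i then 0 else c.K x y

/-- `P_j(τ_i > m)`, where `τ_i` is the discrete-time hitting time of state `i`. -/
def hitSurv (c : BDChain n) (i j : Fin (n + 1)) (m : ℕ) : ℝ :=
  if j = i then 0 else ∑ y, (c.killed i ^ m) j y

/-- `P_j(τ̃_i > t)`, where `τ̃_i` is the continuous-time hitting time of state `i`. -/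
def hitSurvC (c : BDChain n) (i j : Fin (n + 1)) (t : ℝ) : ℝ :=
  ∑' m : ℕ, (Real.exp (-t) * t ^ m / m.factorial) * c.hitSurv i j m

/-- `E_j τ_i` -/
def hitMean (c : BDChain n) (i j : Fin (n + 1)) : ℝ :=
  ∑' m : ℕ, c.hitSurv i j m

/-- `Var_j τ_i` -/
def hitVar (c : BDChain n) (i j : Fin (n + 1)) : ℝ :=
  (∑' m : ℕ, (2 * (m : ℝ) + 1) * c.hitSurv i j m) - (c.hitMean i j) ^ 2

/-- `E_j τ̃_i` -/
def hitMeanC (c : BDChain n) (i j : Fin (n + 1)) : ℝ :=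
  ∫ t in Set.Ioi (0 : ℝ), c.hitSurvC i j t

/-- `Var_j τ̃_i` -/
def hitVarC (c : BDChain n) (i j : Fin (n + 1)) : ℝ :=
  (∫ t in Set.Ioi (0 : ℝ), 2 * t * c.hitSurvC i j t) - (c.hitMeanC i j) ^ 2

/-- The substochastic matrix of the chain killed at states `i` and `k`. -/
def killed2 (c : BDChain n) (i k : Fin (n + 1)) : Matrix (Fin (n + 1)) (Fin (n + 1)) ℝ :=
  Matrix.of fun x y => if x = i ∨ x = k ∨ y = i ∨ y = k then 0 else c.K x y

/-- `P_j(min{τ_i, τ_k} > m)` -/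
def hitSurv2 (c : BDChain n) (i k j : Fin (n + 1)) (m : ℕ) : ℝ :=
  if j = i ∨ j = k then 0 else ∑ y, (c.killed2 i k ^ m) j y

/-- `E_j min{τ_i, τ_k}` -/
def hitMean2 (c : BDChain n) (i k j : Fin (n + 1)) : ℝ :=
  ∑' m : ℕ, c.hitSurv2 i k j m

/-- `E_j min{τ̃_i, τ̃_k}` -/
def hitMean2C (c : BDChain n) (i k j : Fin (n + 1)) : ℝ :=
  ∫ t in Set.Ioi (0 : ℝ),
    ∑' m : ℕ, (Real.exp (-t) * t ^ m / m.factorial) * c.hitSurv2 i k j m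

/-- The continuous-time kernel `H_t(x,y) = e^{-t(I-K)}(x,y)`. -/
def Ht (c : BDChain n) (t : ℝ) (x y : Fin (n + 1)) : ℝ :=
  ∑' m : ℕ, (Real.exp (-t) * t ^ m / m.factorial) * (c.K ^ m) x y

/-- Discrete-time total variation distance from starting state `x` at time `m`. -/
def dTV (c : BDChain n) (x : Fin (n + 1)) (m : ℕ) : ℝ :=
  ⨆ A : Finset (Fin (n + 1)), (∑ y ∈ A, (c.K ^ m) x y - ∑ y ∈ A, c.pi y)

/-- Continuous-time total variation distance from starting state `x` at time `t`. -/
def dTVC (c : BDChain n) (x : Fin (n + 1)) (t : ℝ) : ℝ :=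
  ⨆ A : Finset (Fin (n + 1)), (∑ y ∈ A, c.Ht t x y - ∑ y ∈ A, c.pi y)

/-- Maximum (over starting states) discrete-time total variation distance. -/
def dTVMax (c : BDChain n) (m : ℕ) : ℝ := ⨆ x, c.dTV x m

/-- Maximum (over starting states) continuous-time total variation distance. -/
def dTVMaxC (c : BDChain n) (t : ℝ) : ℝ := ⨆ x, c.dTVC x t

/-- Discrete-time separation from starting state `x` at time `m`. -/
def sep (c : BDChain n) (x : Fin (n + 1)) (m : ℕ) : ℝ :=
  ⨆ y, (1 - (c.K ^ m) x y / c.pi y)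

/-- Continuous-time separation from starting state `x` at time `t`. -/
def sepC (c : BDChain n) (x : Fin (n + 1)) (t : ℝ) : ℝ :=
  ⨆ y, (1 - c.Ht t x y / c.pi y)

end BDChain

/-- Discrete-time `ε`-mixing time for a distance profile `d`. -/
def mixD (d : ℕ → ℝ) (ε : ℝ) : ℕ := sInf {m : ℕ | d m ≤ ε}

/-- Continuous-time `ε`-mixing time for a distance profile `d`. -/
def mixC (d : ℝ → ℝ) (ε : ℝ) : ℝ := sInf {t : ℝ | 0 ≤ t ∧ d t ≤ ε}

/-- The set of (real) eigenvalues of a square matrix. -/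
def eigSet {ι : Type*} [Fintype ι] (M : Matrix ι ι ℝ) : Set ℝ :=
  {x | ∃ v : ι → ℝ, v ≠ 0 ∧ M.mulVec v = x • v}

/-- `l` is the smallest non-zero eigenvalue of `M`. -/
def IsSmallestNonzeroEig {ι : Type*} [Fintype ι] (M : Matrix ι ι ℝ) (l : ℝ) : Prop :=
  l ∈ eigSet M ∧ l ≠ 0 ∧ ∀ x ∈ eigSet M, x ≠ 0 → l ≤ x

/-- `l` is the smallest eigenvalue of `M`. -/
def IsSmallestEig {ι : Type*} [Fintype ι] (M : Matrix ι ι ℝ) (l : ℝ) : Prop :=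
  l ∈ eigSet M ∧ ∀ x ∈ eigSet M, l ≤ x

/-- The principal submatrix of `I - K` indexed by the states `0, 1, ..., M-1`. -/
def BDChain.subIK {n : ℕ} (c : BDChain n) (M : Fin (n + 1)) :
    Matrix (Fin (M : ℕ)) (Fin (M : ℕ)) ℝ :=
  Matrix.of fun a b =>
    (1 - c.K) (Fin.castLE M.isLt.le a) (Fin.castLE M.isLt.le b)

/-- A family of chains, with `ε ↦ n ↦ T ε n` the mixing time profile, presents a cutoff
with cutoff time `t`. -/
def cutoffWith (T : ℝ → ℕ → ℝ) (t : ℕ → ℝ) : Prop :=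
  ∀ ε ∈ Set.Ioo (0 : ℝ) 1, Filter.Tendsto (fun n => T ε n / t n) Filter.atTop (nhds 1)

/-- A family of chains presents a cutoff. -/
def hasCutoff (T : ℝ → ℕ → ℝ) : Prop :=
  ∃ t : ℕ → ℝ, (∀ n, 0 < t n) ∧ cutoffWith T t

/-- A family of chains presents a `(t_n, b_n)` cutoff. -/
def cutoffWindow (T : ℝ → ℕ → ℝ) (t b : ℕ → ℝ) : Prop :=
  (∀ᶠ n in Filter.atTop, 0 < t n) ∧ (∀ᶠ n in Filter.atTop, 0 < b n) ∧
  Filter.Tendsto (fun n => b n / t n) Filter.atTop (nhds 0) ∧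
  ∀ ε ∈ Set.Ioo (0 : ℝ) 1, ∃ C : ℝ, ∀ᶠ n in Filter.atTop, |T ε n - t n| ≤ C * b n


/-! ### Spectral theory of matrices that are symmetric with respect to a weight -/

section Weighted

variable {m : ℕ} {M : Matrix (Fin m) (Fin m) ℝ} {w : Fin m → ℝ}

theorem exists_weighted_eigenbasis (hw : ∀ x, 0 < w x)
    (hM : ∀ x y, w x * M x y = w y * M y x) :
    ∃ (μ : Fin m → ℝ) (b : Module.Basis (Fin m) ℝ (Fin m → ℝ)), Monotone μ ∧
      (∀ j, M *ᵥ b j = μ j • b j) ∧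
      ∀ j k, ∑ x, w x * (b j x * b k x) = if j = k then 1 else 0 := by
  have hs : ∀ x, 0 < √(w x) := fun x => Real.sqrt_pos.2 (hw x)
  have hss : ∀ x, √(w x) * √(w x) = w x := fun x => Real.mul_self_sqrt (hw x).le
  let S : Matrix (Fin m) (Fin m) ℝ := Matrix.of fun x y => √(w x) * M x y / √(w y)
  have hS : S.IsHermitian := by
    ext x y
    simp only [S, conjTranspose_apply, of_apply, star_trivial]
    have := hM x y
    rw [← hss x, ← hss y] at this
    rw [div_eq_div_iff (hs x).ne' (hs y).ne']
    linear_combination -this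
  let σ := Tuple.sort hS.eigenvalues
  let f : Fin m → Fin m → ℝ := fun j x => hS.eigenvectorBasis (σ j) x / √(w x)
  have hf : ∀ j k, ∑ x, w x * (f j x * f k x) = if j = k then 1 else 0 := by
    intro j k
    have h := (orthonormal_iff_ite.1 hS.eigenvectorBasis.orthonormal) (σ k) (σ j)
    rw [PiLp.inner_apply] at h
    simp only [EmbeddingLike.apply_eq_iff_eq] at h
    have hjk : (if j = k then (1 : ℝ) else 0) = if k = j then 1 else 0 := by simp only [eq_comm]
    rw [hjk, ← h]
    refine Finset.sum_congr rfl fun x _ => ?_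
    simp only [f, RCLike.inner_apply, conj_trivial]
    rw [div_mul_div_comm, hss, mul_div_cancel₀ _ (hw x).ne']
  have hlin : LinearIndependent ℝ f := by
    rw [Fintype.linearIndependent_iff]
    intro g hg k
    have h : ∑ x, w x * ((∑ j, g j • f j) x * f k x) = g k := by
      simp only [Finset.sum_apply, Pi.smul_apply, smul_eq_mul, Finset.sum_mul, Finset.mul_sum]
      rw [Finset.sum_comm]
      have : ∀ j, ∑ x, w x * (g j * f j x * f k x) = g j * if j = k then 1 else 0 := by
        intro j
        rw [← hf, Finset.mul_sum]
        exact Finset.sum_congr rfl fun x _ => by ring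
      simp [this]
    rw [← h, hg]
    simp
  let b := basisOfLinearIndependentOfCardEqFinrank' f hlin (by simp)
  have hb : ∀ j, b j = f j := fun j => by simp [b]
  refine ⟨hS.eigenvalues ∘ σ, b, Tuple.monotone_sort _, fun j => ?_, fun j k => ?_⟩
  · rw [hb]
    ext x
    have h := congrFun (hS.mulVec_eigenvectorBasis (σ j)) x
    simp only [mulVec, dotProduct, S, of_apply, Pi.smul_apply, smul_eq_mul] at h
    simp only [mulVec, dotProduct, f, Pi.smul_apply, smul_eq_mul, Function.comp]
    rw [← mul_div_assoc, ← h, Finset.sum_div]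
    refine Finset.sum_congr rfl fun y _ => ?_
    have := (hs x).ne'
    have := (hs y).ne'
    field_simp
  · rw [hb, hb, hf]

variable {μ : Fin m → ℝ} {b : Module.Basis (Fin m) ℝ (Fin m → ℝ)}

theorem toMatrix_eq_diagonal_of_eigenbasis (hb : ∀ j, M *ᵥ b j = μ j • b j) :
    LinearMap.toMatrix b b (Matrix.toLin' M) = Matrix.diagonal μ := by
  ext i j
  rw [LinearMap.toMatrix_apply, Matrix.toLin'_apply, hb]
  simp [Matrix.diagonal_apply, Finsupp.single_apply]
  grind

theorem charpoly_eq_of_eigenbasis (hb : ∀ j, M *ᵥ b j = μ j • b j) :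
    M.charpoly = ∏ j, (X - C (μ j)) := by
  rw [← Matrix.charpoly_toLin', ← LinearMap.charpoly_toMatrix _ b,
    toMatrix_eq_diagonal_of_eigenbasis hb, Matrix.charpoly_diagonal]

theorem trace_eq_of_eigenbasis (hb : ∀ j, M *ᵥ b j = μ j • b j) : M.trace = ∑ j, μ j := by
  rw [← Matrix.trace_toLin'_eq, LinearMap.trace_eq_matrix_trace ℝ b,
    toMatrix_eq_diagonal_of_eigenbasis hb, Matrix.trace_diagonal]

theorem det_eq_of_eigenbasis (hb : ∀ j, M *ᵥ b j = μ j • b j) : M.det = ∏ j, μ j := by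
  rw [← LinearMap.det_toLin', ← LinearMap.det_toMatrix b,
    toMatrix_eq_diagonal_of_eigenbasis hb, Matrix.det_diagonal]

/-- A Parseval-type formula for the quadratic form of `M`. -/
theorem weighted_form_eq (hb : ∀ j, M *ᵥ b j = μ j • b j)
    (ho : ∀ j k, ∑ x, w x * (b j x * b k x) = if j = k then 1 else 0) (f : Fin m → ℝ) :
    ∑ x, w x * (f x * (M *ᵥ f) x) = ∑ j, μ j * b.repr f j ^ 2 := by
  have hf : ∀ x, f x = ∑ j, b.repr f j * b j x := fun x => by
    conv_lhs => rw [← b.sum_repr f]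
    simp
  have hMf : ∀ x, (M *ᵥ f) x = ∑ j, b.repr f j * (μ j * b j x) := fun x => by
    conv_lhs => rw [← b.sum_repr f, Matrix.mulVec_sum]
    simp [Matrix.mulVec_smul, hb]
  have key : ∀ x, w x * (f x * (M *ᵥ f) x) =
      ∑ j, ∑ k, (b.repr f j * b.repr f k * μ k) * (w x * (b j x * b k x)) := fun x => by
    rw [hMf]
    conv_lhs => rw [hf x]
    rw [Finset.sum_mul_sum, Finset.mul_sum]
    refine Finset.sum_congr rfl fun j _ => ?_
    rw [Finset.mul_sum]
    exact Finset.sum_congr rfl fun k _ => by ring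
  simp only [key]
  rw [Finset.sum_comm]
  refine Finset.sum_congr rfl fun j _ => ?_
  rw [Finset.sum_comm]
  simp only [← Finset.mul_sum, ho]
  simp
  ring

theorem weighted_norm_eq
    (ho : ∀ j k, ∑ x, w x * (b j x * b k x) = if j = k then 1 else 0) (f : Fin m → ℝ) :
    ∑ x, w x * (f x * f x) = ∑ j, b.repr f j ^ 2 := by
  simpa using weighted_form_eq (M := 1) (μ := 1) (b := b) (w := w) (by simp) ho f

/-- Half of the Courant–Fischer principle: the span of the first `k + 1` eigenvectors. -/
theorem exists_low_subspace (hμ : Monotone μ) (hb : ∀ j, M *ᵥ b j = μ j • b j)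
    (ho : ∀ j k, ∑ x, w x * (b j x * b k x) = if j = k then 1 else 0) (k : Fin m) :
    ∃ U : Submodule ℝ (Fin m → ℝ), Module.finrank ℝ U = k + 1 ∧
      ∀ f ∈ U, ∑ x, w x * (f x * (M *ᵥ f) x) ≤ μ k * ∑ x, w x * (f x * f x) := by
  refine ⟨Submodule.span ℝ (b '' Set.Iic k), ?_, fun f hf => ?_⟩
  · rw [Set.image_eq_range]
    refine (finrank_span_eq_card (b.linearIndependent.comp _ Subtype.val_injective)).trans ?_
    rw [← Set.toFinset_card]
    simp
  · rw [b.mem_span_image] at hf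
    rw [weighted_form_eq hb ho, weighted_norm_eq ho, Finset.mul_sum]
    refine Finset.sum_le_sum fun j _ => ?_
    by_cases h : b.repr f j = 0
    · simp [h]
    · have : j ≤ k := hf (by simpa using h)
      exact mul_le_mul_of_nonneg_right (hμ this) (sq_nonneg _)

/-- Half of the Courant–Fischer principle: the span of the last `m - k` eigenvectors. -/
theorem exists_high_subspace (hμ : Monotone μ) (hb : ∀ j, M *ᵥ b j = μ j • b j)
    (ho : ∀ j k, ∑ x, w x * (b j x * b k x) = if j = k then 1 else 0) (k : Fin m) :
    ∃ U : Submodule ℝ (Fin m → ℝ), Module.finrank ℝ U = m - k ∧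
      ∀ f ∈ U, μ k * ∑ x, w x * (f x * f x) ≤ ∑ x, w x * (f x * (M *ᵥ f) x) := by
  refine ⟨Submodule.span ℝ (b '' Set.Ici k), ?_, fun f hf => ?_⟩
  · rw [Set.image_eq_range]
    refine (finrank_span_eq_card (b.linearIndependent.comp _ Subtype.val_injective)).trans ?_
    rw [← Set.toFinset_card]
    simp
  · rw [b.mem_span_image] at hf
    rw [weighted_form_eq hb ho, weighted_norm_eq ho, Finset.mul_sum]
    refine Finset.sum_le_sum fun j _ => ?_
    by_cases h : b.repr f j = 0
    · simp [h]
    · have : k ≤ j := hf (by simpa using h)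
      exact mul_le_mul_of_nonneg_right (hμ this) (sq_nonneg _)

/-- Two quadratic-form bounds on subspaces of large total dimension are comparable. -/
theorem le_of_form_bounds (hw : ∀ x, 0 < w x) {U W : Submodule ℝ (Fin m → ℝ)} {r s : ℝ}
    (hdim : m < Module.finrank ℝ U + Module.finrank ℝ W)
    (hU : ∀ f ∈ U, ∑ x, w x * (f x * (M *ᵥ f) x) ≤ s * ∑ x, w x * (f x * f x))
    (hW : ∀ f ∈ W, r * ∑ x, w x * (f x * f x) ≤ ∑ x, w x * (f x * (M *ᵥ f) x)) : r ≤ s := by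
  have hne : U ⊓ W ≠ ⊥ := by
    intro h
    have h1 := Submodule.finrank_sup_add_finrank_inf_eq U W
    have h2 := Submodule.finrank_le (U ⊔ W)
    rw [h, finrank_bot] at h1
    simp at h2
    omega
  obtain ⟨f, ⟨hfU, hfW⟩, hf⟩ := Submodule.exists_mem_ne_zero_of_ne_bot hne
  obtain ⟨x₀, hx₀⟩ := Function.ne_iff.1 hf
  have hpos : 0 < ∑ x, w x * (f x * f x) :=
    Finset.sum_pos' (fun x _ => mul_nonneg (hw x).le (mul_self_nonneg _))
      ⟨x₀, Finset.mem_univ _, mul_pos (hw x₀) (mul_self_pos.2 hx₀)⟩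
  exact le_of_mul_le_mul_right ((hW f hfW).trans (hU f hfU)) hpos

end Weighted

/-- Extension by zero of a function on the complement of `i`. -/
def extendZero {n : ℕ} (i : Fin (n + 1)) : (Fin n → ℝ) →ₗ[ℝ] (Fin (n + 1) → ℝ) where
  toFun f := i.insertNth (α := fun _ => ℝ) 0 f
  map_add' f g := by
    ext x
    refine Fin.succAboveCases i ?_ (fun a => ?_) x <;> simp
  map_smul' r f := by
    ext x
    refine Fin.succAboveCases i ?_ (fun a => ?_) x <;> simp

@[simp] theorem extendZero_same {n : ℕ} (i : Fin (n + 1)) (f : Fin n → ℝ) :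
    extendZero i f i = 0 := by
  simp [extendZero]

@[simp] theorem extendZero_succAbove {n : ℕ} (i : Fin (n + 1)) (f : Fin n → ℝ) (a : Fin n) :
    extendZero i f (i.succAbove a) = f a := by
  simp [extendZero]

theorem extendZero_injective {n : ℕ} (i : Fin (n + 1)) : Function.Injective (extendZero i) := by
  intro f g h
  ext a
  simpa using congrFun h (i.succAbove a)

theorem mulVec_extendZero_succAbove {n : ℕ} (i : Fin (n + 1))
    (M : Matrix (Fin (n + 1)) (Fin (n + 1)) ℝ) (f : Fin n → ℝ) (a : Fin n) :
    (M *ᵥ extendZero i f) (i.succAbove a) = (M.submatrix i.succAbove i.succAbove *ᵥ f) a := by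
  simp [mulVec, dotProduct, Fin.sum_univ_succAbove _ i]

/-- Cauchy interlacing for the deletion of one row and column. -/
theorem cauchy_interlacing {n : ℕ} {M : Matrix (Fin (n + 1)) (Fin (n + 1)) ℝ} {w : Fin (n + 1) → ℝ}
    (hw : ∀ x, 0 < w x) (i : Fin (n + 1))
    {μ : Fin (n + 1) → ℝ} {b : Module.Basis (Fin (n + 1)) ℝ (Fin (n + 1) → ℝ)} (hμ : Monotone μ)
    (hb : ∀ j, M *ᵥ b j = μ j • b j)
    (ho : ∀ j k, ∑ x, w x * (b j x * b k x) = if j = k then 1 else 0)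
    {γ : Fin n → ℝ} {d : Module.Basis (Fin n) ℝ (Fin n → ℝ)} (hγ : Monotone γ)
    (hd : ∀ j, M.submatrix i.succAbove i.succAbove *ᵥ d j = γ j • d j)
    (hdo : ∀ j k, ∑ x, w (i.succAbove x) * (d j x * d k x) = if j = k then 1 else 0) (j : Fin n) :
    μ j.castSucc ≤ γ j ∧ γ j ≤ μ j.succ := by
  have hform : ∀ f : Fin n → ℝ, ∑ x, w x * (extendZero i f x * (M *ᵥ extendZero i f) x) =
      ∑ a, w (i.succAbove a) * (f a * (M.submatrix i.succAbove i.succAbove *ᵥ f) a) := fun f => by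
    simp [Fin.sum_univ_succAbove _ i, mulVec_extendZero_succAbove]
  have hnorm : ∀ f : Fin n → ℝ, ∑ x, w x * (extendZero i f x * extendZero i f x) =
      ∑ a, w (i.succAbove a) * (f a * f a) := fun f => by
    simp [Fin.sum_univ_succAbove _ i]
  have hj := j.isLt
  constructor
  · obtain ⟨U, hU, hU'⟩ := exists_low_subspace hγ hd hdo j
    obtain ⟨W, hW, hW'⟩ := exists_high_subspace hμ hb ho j.castSucc
    refine le_of_form_bounds (U := U.map (extendZero i)) hw ?_ ?_ hW'
    · rw [← (Submodule.equivMapOfInjective _ (extendZero_injective i) _).finrank_eq, hU, hW, Fin.val_castSucc]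
      omega
    · rintro _ ⟨f, hf, rfl⟩
      rw [hform, hnorm]
      exact hU' f hf
  · obtain ⟨W, hW, hW'⟩ := exists_high_subspace hγ hd hdo j
    obtain ⟨U, hU, hU'⟩ := exists_low_subspace hμ hb ho j.succ
    refine le_of_form_bounds (W := W.map (extendZero i)) hw ?_ hU' ?_
    · rw [← (Submodule.equivMapOfInjective _ (extendZero_injective i) _).finrank_eq, hU, hW, Fin.val_succ]
      omega
    · rintro _ ⟨f, hf, rfl⟩
      rw [hform, hnorm]
      exact hW' f hf

theorem eq_of_monotone_of_prod_X_sub_C_eq {m : ℕ} {f g : Fin m → ℝ} (hf : Monotone f)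
    (hg : Monotone g) (h : ∏ j, (X - C (f j)) = ∏ j, (X - C (g j))) : f = g := by
  have hr : ∀ f : Fin m → ℝ, (∏ j, (X - C (f j))).roots = Finset.univ.val.map f := fun f => by
    rw [← Polynomial.roots_multiset_prod_X_sub_C (Finset.univ.val.map f), Multiset.map_map]
    rfl
  have hm : (Finset.univ.val.map f) = Finset.univ.val.map g := by rw [← hr, h, hr]
  have hl : List.ofFn f = List.ofFn g := by
    refine List.Perm.eq_of_pairwise (le := (· ≤ ·)) (fun a b _ _ h1 h2 => le_antisymm h1 h2) ?_ ?_ ?_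
    · exact List.pairwise_ofFn.2 fun _ _ h => hf h.le
    · exact List.pairwise_ofFn.2 fun _ _ h => hg h.le
    · rw [← Multiset.coe_eq_coe]
      simpa [Fin.univ_val_map] using hm
  exact List.ofFn_injective hl

/-- Interlaced sequences have comparable sums of a decreasing function. -/
theorem sum_interlaced_bounds {n : ℕ} {g : ℝ → ℝ} (hg : AntitoneOn g (Set.Ioc 0 2))
    {lam γ : Fin (n + 1) → ℝ} (hl : ∀ j, lam j ≤ 2) (hγ : ∀ j, 0 < γ j)
    (h1 : ∀ j, γ j ≤ lam j) (h2 : ∀ j : Fin n, lam j.castSucc ≤ γ j.succ) :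
    ∑ j, g (lam j) ≤ ∑ j, g (γ j) ∧
      ∑ j, g (γ j) ≤ ∑ j, g (lam j) + g (γ 0) - g (lam (Fin.last n)) := by
  have hl0 : ∀ j, 0 < lam j := fun j => (hγ j).trans_le (h1 j)
  refine ⟨Finset.sum_le_sum fun j _ => hg ⟨hγ j, (h1 j).trans (hl j)⟩ ⟨hl0 j, hl j⟩ (h1 j), ?_⟩
  rw [Fin.sum_univ_succ, Fin.sum_univ_castSucc (fun j => g (lam j))]
  have : ∑ j : Fin n, g (γ j.succ) ≤ ∑ j : Fin n, g (lam j.castSucc) :=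
    Finset.sum_le_sum fun j _ =>
      hg ⟨hl0 _, hl _⟩ ⟨hγ _, (h1 _).trans (hl _)⟩ (h2 j)
  linarith

/-! ### Moments of hitting times as solutions of linear systems -/

theorem abs_pow_mulVec_le {ι : Type*} [Fintype ι] [DecidableEq ι] {k : Matrix ι ι ℝ}
    (hk : ∀ x y, 0 ≤ k x y) {f g : ι → ℝ} (hfg : ∀ x, |f x| ≤ g x) (m : ℕ) (x : ι) :
    |(k ^ m *ᵥ f) x| ≤ (k ^ m *ᵥ g) x := by
  induction m generalizing x with
  | zero => simpa using hfg x
  | succ m ih =>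
    rw [pow_succ', ← mulVec_mulVec, ← mulVec_mulVec]
    refine (Finset.abs_sum_le_sum_abs _ _).trans (Finset.sum_le_sum fun y _ => ?_)
    rw [abs_mul, abs_of_nonneg (hk x y)]
    exact mul_le_mul_of_nonneg_left (ih y) (hk x y)

/-- If `u = s + k u` and `v = u + k v` for a nonnegative matrix `k`, and `s` dominates `u` and `v`,
then `u = ∑ kᵐ s` and `v = ∑ (m + 1) kᵐ s`. -/
theorem hasSum_pow_mulVec {ι : Type*} [Fintype ι] [DecidableEq ι] {k : Matrix ι ι ℝ}
    (hk : ∀ x y, 0 ≤ k x y) {s u v : ι → ℝ} {C : ℝ} (hC : 1 ≤ C) (hs : ∀ x, 0 ≤ s x)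
    (hu0 : ∀ x, 0 ≤ u x) (hu : u = s + k *ᵥ u) (hv : v = u + k *ᵥ v)
    (huC : ∀ x, u x ≤ C * s x) (hvC : ∀ x, |v x| ≤ C * s x) (x : ι) :
    HasSum (fun m : ℕ => (k ^ m *ᵥ s) x) (u x) ∧
      HasSum (fun m : ℕ => ((m : ℝ) + 1) * (k ^ m *ᵥ s) x) (v x) := by
  have hC0 : 0 < C := by linarith
  have hs' : ∀ m x, 0 ≤ (k ^ m *ᵥ s) x := fun m x =>
    (abs_nonneg _).trans (abs_pow_mulVec_le hk (fun x => (abs_of_nonneg (hs x)).le) m x)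
  have hu' : ∀ m x, 0 ≤ (k ^ m *ᵥ u) x := fun m x =>
    (abs_nonneg _).trans (abs_pow_mulVec_le hk (fun x => (abs_of_nonneg (hu0 x)).le) m x)
  have hpow : ∀ (m : ℕ) (f : ι → ℝ), k ^ (m + 1) *ᵥ f = k ^ m *ᵥ (k *ᵥ f) := fun m f => by
    rw [mulVec_mulVec, ← pow_succ]
  have hsu : ∀ m : ℕ, (k ^ m *ᵥ s) x = (k ^ m *ᵥ u) x - (k ^ (m + 1) *ᵥ u) x := fun m => by
    have : s = u - k *ᵥ u := eq_sub_of_add_eq hu.symm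
    rw [hpow]
    nth_rewrite 1 [this]
    rw [mulVec_sub]
    rfl
  have huv : ∀ m : ℕ, (k ^ m *ᵥ u) x = (k ^ m *ᵥ v) x - (k ^ (m + 1) *ᵥ v) x := fun m => by
    have : u = v - k *ᵥ v := eq_sub_of_add_eq hv.symm
    rw [hpow]
    nth_rewrite 1 [this]
    rw [mulVec_sub]
    rfl
  set r : ℝ := 1 - 1 / C with hr
  have hr0 : 0 ≤ r := by
    rw [hr, sub_nonneg, div_le_one hC0]
    exact hC
  have hr1 : r < 1 := by
    rw [hr]
    have : 0 < 1 / C := by positivity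
    linarith
  have hku : ∀ y, (k *ᵥ u) y ≤ r * u y := fun y => by
    have h1 : u y = s y + (k *ᵥ u) y := congrFun hu y
    have h2 : u y / C ≤ s y := by
      rw [div_le_iff₀ hC0]
      linarith [huC y]
    have h3 : r * u y = u y - u y / C := by
      rw [hr]
      ring
    linarith
  have hdec : ∀ (m : ℕ) (y : ι), (k ^ m *ᵥ u) y ≤ r ^ m * u y := by
    intro m
    induction m with
    | zero => simp
    | succ m ih =>
      intro y
      rw [pow_succ', ← mulVec_mulVec]
      calc (k *ᵥ (k ^ m *ᵥ u)) y ≤ (k *ᵥ (r ^ m • u)) y :=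
            Finset.sum_le_sum fun z _ => mul_le_mul_of_nonneg_left (ih z) (hk y z)
        _ = r ^ m * (k *ᵥ u) y := by rw [mulVec_smul]; rfl
        _ ≤ r ^ m * (r * u y) := mul_le_mul_of_nonneg_left (hku y) (pow_nonneg hr0 m)
        _ = r ^ (m + 1) * u y := by ring
  have ht0 : Tendsto (fun m : ℕ => (k ^ m *ᵥ u) x) atTop (nhds 0) := by
    have := (tendsto_pow_atTop_nhds_zero_of_lt_one hr0 hr1).mul_const (u x)
    rw [zero_mul] at this
    exact squeeze_zero (fun m => hu' m x) (fun m => hdec m x) this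
  have ht1 : Tendsto (fun m : ℕ => (m : ℝ) * (k ^ m *ᵥ u) x) atTop (nhds 0) := by
    have := (tendsto_self_mul_const_pow_of_lt_one hr0 hr1).mul_const (u x)
    rw [zero_mul] at this
    refine squeeze_zero (fun m => mul_nonneg m.cast_nonneg (hu' m x)) (fun m => ?_) this
    rw [mul_assoc]
    exact mul_le_mul_of_nonneg_left (hdec m x) m.cast_nonneg
  have hsle : ∀ y, s y ≤ u y := fun y => by
    have h1 : u y = s y + (k *ᵥ u) y := congrFun hu y
    have h2 := hu' 1 y
    rw [pow_one] at h2
    linarith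
  have ht2 : Tendsto (fun m : ℕ => (k ^ m *ᵥ v) x) atTop (nhds 0) := by
    have hCu := ht0.const_mul C
    rw [mul_zero] at hCu
    refine squeeze_zero_norm (fun m => ?_) hCu
    rw [Real.norm_eq_abs]
    refine (abs_pow_mulVec_le hk (g := C • u) (fun y => (hvC y).trans ?_) m x).trans ?_
    · exact mul_le_mul_of_nonneg_left (hsle y) hC0.le
    · rw [mulVec_smul]
      rfl
  constructor
  · rw [hasSum_iff_tendsto_nat_of_nonneg fun m => hs' m x]
    have hsum : ∀ N : ℕ, ∑ m ∈ Finset.range N, (k ^ m *ᵥ s) x = u x - (k ^ N *ᵥ u) x := by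
      intro N
      simp only [hsu]
      rw [Finset.sum_range_sub']
      simp
    simp only [hsum]
    simpa using tendsto_const_nhds.sub ht0
  · rw [hasSum_iff_tendsto_nat_of_nonneg fun m => mul_nonneg (by positivity) (hs' m x)]
    have hsum : ∀ N : ℕ, ∑ m ∈ Finset.range N, ((m : ℝ) + 1) * (k ^ m *ᵥ s) x =
        v x - (k ^ N *ᵥ v) x - N * (k ^ N *ᵥ u) x := by
      intro N
      induction N with
      | zero => simp
      | succ N ih =>
        rw [Finset.sum_range_succ, ih, hsu]
        have := huv N
        push_cast
        linear_combination this
    simp only [hsum]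
    simpa using (tendsto_const_nhds.sub ht2).sub ht1

theorem integrableOn_exp_neg_mul_pow (m : ℕ) :
    IntegrableOn (fun t : ℝ => Real.exp (-t) * t ^ m) (Set.Ioi 0) := by
  have := Real.GammaIntegral_convergent (s := (m : ℝ) + 1) (by positivity)
  simpa using this

theorem integral_exp_neg_mul_pow (m : ℕ) :
    ∫ t in Set.Ioi (0 : ℝ), Real.exp (-t) * t ^ m = m.factorial := by
  rw [← Real.Gamma_nat_eq_factorial, Real.Gamma_eq_integral (by positivity)]
  simp

/-- The mean of a continuous-time lifetime with Poissonized survival function. -/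
theorem integral_poissonized {s : ℕ → ℝ} {U : ℝ} (hs : ∀ m, 0 ≤ s m) (hU : HasSum s U) :
    ∫ t in Set.Ioi (0 : ℝ), ∑' m : ℕ, (Real.exp (-t) * t ^ m / m.factorial) * s m = U := by
  have hform : ∀ (m : ℕ) (t : ℝ), Real.exp (-t) * t ^ m / m.factorial * s m =
      (s m / m.factorial) * (Real.exp (-t) * t ^ m) := fun m t => by ring
  have hint : ∀ m : ℕ,
      ∫ t in Set.Ioi (0 : ℝ), (Real.exp (-t) * t ^ m / m.factorial) * s m = s m := fun m => by
    simp only [hform]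
    rw [integral_const_mul, integral_exp_neg_mul_pow]
    field_simp
  have h := hasSum_integral_of_summable_integral_norm (μ := volume.restrict (Set.Ioi (0 : ℝ)))
    (F := fun (m : ℕ) (t : ℝ) => (Real.exp (-t) * t ^ m / m.factorial) * s m)
    (fun m => by
      simp only [hform]
      exact (integrableOn_exp_neg_mul_pow m).const_mul _)
    (by
      refine hU.summable.congr fun m => (hint m).symm.trans ?_
      refine setIntegral_congr_fun measurableSet_Ioi fun t ht => ?_
      have ht : 0 < t := ht
      have := hs m
      exact (Real.norm_of_nonneg (by positivity)).symm)
  simp only [hint] at h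
  exact h.unique hU

/-- The second moment of a continuous-time lifetime with Poissonized survival function. -/
theorem integral_mul_poissonized {s : ℕ → ℝ} {V : ℝ} (hs : ∀ m, 0 ≤ s m)
    (hV : HasSum (fun m : ℕ => ((m : ℝ) + 1) * s m) V) :
    ∫ t in Set.Ioi (0 : ℝ),
      2 * t * ∑' m : ℕ, (Real.exp (-t) * t ^ m / m.factorial) * s m = 2 * V := by
  have hform : ∀ (m : ℕ) (t : ℝ), 2 * t * (Real.exp (-t) * t ^ m / m.factorial * s m) =
      (2 * s m / m.factorial) * (Real.exp (-t) * t ^ (m + 1)) := fun m t => by ring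
  have hint : ∀ m : ℕ,
      ∫ t in Set.Ioi (0 : ℝ), 2 * t * ((Real.exp (-t) * t ^ m / m.factorial) * s m) =
        2 * (((m : ℝ) + 1) * s m) := fun m => by
    simp only [hform]
    rw [integral_const_mul, integral_exp_neg_mul_pow, Nat.factorial_succ]
    push_cast
    field_simp
  have h := hasSum_integral_of_summable_integral_norm (μ := volume.restrict (Set.Ioi (0 : ℝ)))
    (F := fun (m : ℕ) (t : ℝ) => 2 * t * ((Real.exp (-t) * t ^ m / m.factorial) * s m))
    (fun m => by
      simp only [hform]
      exact (integrableOn_exp_neg_mul_pow (m + 1)).const_mul _)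
    (by
      refine (hV.summable.mul_left 2).congr fun m => (hint m).symm.trans ?_
      refine setIntegral_congr_fun measurableSet_Ioi fun t ht => ?_
      have ht : 0 < t := ht
      have := hs m
      exact (Real.norm_of_nonneg (by positivity)).symm)
  simp only [hint, tsum_mul_left] at h
  exact h.unique (hV.mul_left 2)

/-! ### Birth and death chains -/

namespace BDChain

variable {n : ℕ} (c : BDChain n)

theorem detailed_balance (x y : Fin (n + 1)) : c.pi x * c.K x y = c.pi y * c.K y x := by
  have key : ∀ k : ℕ, ∀ x y : Fin (n + 1), (x : ℕ) = k →
      c.pi x * c.K x y - c.pi y * c.K y x = 0 := by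
    intro k
    induction k using Nat.strong_induction_on with
    | _ k ih =>
      intro x y hx
      have hzero : ∀ z : Fin (n + 1), (z : ℕ) ≠ k + 1 →
          c.pi x * c.K x z - c.pi z * c.K z x = 0 := by
        intro z hz
        rcases lt_trichotomy (z : ℕ) k with h | h | h
        · have := ih z h z x rfl
          linarith
        · rw [Fin.ext (h.trans hx.symm : (z : ℕ) = x), sub_self]
        · rw [c.K_tridiag x z (by rw [lt_abs]; omega), c.K_tridiag z x (by rw [lt_abs]; omega)]
          simp
      by_cases hy : (y : ℕ) = k + 1
      · have hsum : ∑ z, (c.pi x * c.K x z - c.pi z * c.K z x) = 0 := by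
          rw [Finset.sum_sub_distrib, ← Finset.mul_sum, c.K_rowSum, c.pi_stat]
          ring
        rwa [Finset.sum_eq_single y (fun z _ hz => hzero z fun h => hz (Fin.ext (h.trans hy.symm)))
          (by simp)] at hsum
      · exact hzero y hy
  linarith [key x x y rfl]

theorem pi_mul_one_sub_K_comm (x y : Fin (n + 1)) :
    c.pi x * (1 - c.K) x y = c.pi y * (1 - c.K) y x := by
  have := c.detailed_balance x y
  simp only [Matrix.sub_apply, mul_sub, this, Matrix.one_apply]
  congr 1
  by_cases h : x = y
  · simp [h]
  · simp [h, Ne.symm h]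

theorem laplacian_apply (f : Fin (n + 1) → ℝ) (x : Fin (n + 1)) :
    ((1 - c.K) *ᵥ f) x = ∑ y, c.K x y * (f x - f y) := by
  simp only [mul_sub, Finset.sum_sub_distrib, ← Finset.sum_mul, c.K_rowSum, one_mul]
  rw [sub_mulVec, one_mulVec]
  rfl

theorem laplacian_one : (1 - c.K) *ᵥ (1 : Fin (n + 1) → ℝ) = 0 := by
  ext x
  simp [laplacian_apply]

theorem sum_pi_mul_laplacian (f : Fin (n + 1) → ℝ) : ∑ x, c.pi x * ((1 - c.K) *ᵥ f) x = 0 := by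
  simp only [sub_mulVec, one_mulVec, Pi.sub_apply, mul_sub, Finset.sum_sub_distrib]
  rw [sub_eq_zero]
  simp only [mulVec, dotProduct, Finset.mul_sum]
  rw [Finset.sum_comm]
  refine Finset.sum_congr rfl fun y _ => ?_
  conv_lhs => rw [← c.pi_stat y, Finset.sum_mul]
  exact Finset.sum_congr rfl fun x _ => by ring

/-- A function harmonic to the left of `y` is constant there. -/
theorem eq_of_harmonic_left {h : Fin (n + 1) → ℝ} {y : Fin (n + 1)}
    (hh : ∀ x < y, ((1 - c.K) *ᵥ h) x = 0) : ∀ x ≤ y, h x = h y := by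
  have key : ∀ k : ℕ, ∀ x : Fin (n + 1), (x : ℕ) = k → x ≤ y → ∀ z ≤ x, h z = h x := by
    intro k
    induction k with
    | zero =>
      intro x hx _ z hz
      rw [Fin.ext (show (z : ℕ) = x by rw [Fin.le_def] at hz; omega)]
    | succ k ih =>
      intro x hx hxy z hz
      rw [Fin.le_def] at hxy hz
      have hk : k < n := by omega
      let x' : Fin (n + 1) := ⟨k, by omega⟩
      have ih' := ih x' rfl (by rw [Fin.le_def]; simp only [x']; omega)
      have hx' : h x' = h x := by
        have h0 := hh x' (by rw [Fin.lt_def]; simp only [x']; omega)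
        rw [laplacian_apply, Finset.sum_eq_single x] at h0
        · have hpos := (c.K_irred k hk).1
          rw [show (⟨k + 1, by omega⟩ : Fin (n + 1)) = x from Fin.ext hx.symm] at hpos
          rcases mul_eq_zero.1 h0 with h1 | h1
          · exact absurd h1 hpos.ne'
          · exact sub_eq_zero.1 h1
        · intro w _ hw
          rcases le_or_gt (w : ℕ) k with hwk | hwk
          · rw [ih' w hwk, sub_self, mul_zero]
          · have : (w : ℕ) ≠ k + 1 := fun e => hw (Fin.ext (e.trans hx.symm))
            rw [c.K_tridiag x' w (by rw [lt_abs]; simp only [x']; omega), zero_mul]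
        · simp
      rcases eq_or_lt_of_le hz with hzx | hzx
      · rw [Fin.ext hzx]
      · rw [ih' z (by rw [Fin.le_def]; simp only [x']; omega), hx']
  exact fun x hx => key y y rfl le_rfl x hx

/-- A function harmonic to the right of `y` is constant there. -/
theorem eq_of_harmonic_right {h : Fin (n + 1) → ℝ} {y : Fin (n + 1)}
    (hh : ∀ x, y < x → ((1 - c.K) *ᵥ h) x = 0) : ∀ x, y ≤ x → h x = h y := by
  have key : ∀ k : ℕ, ∀ x : Fin (n + 1), (x : ℕ) + k = n → y ≤ x → ∀ z, x ≤ z → h z = h x := by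
    intro k
    induction k with
    | zero =>
      intro x hx _ z hz
      rw [Fin.ext (show (z : ℕ) = x by rw [Fin.le_def] at hz; omega)]
    | succ k ih =>
      intro x hx hxy z hz
      rw [Fin.le_def] at hxy hz
      let x' : Fin (n + 1) := ⟨x + 1, by omega⟩
      have ih' := ih x' (by simp only [x']; omega) (by rw [Fin.le_def]; simp only [x']; omega)
      have hx' : h x' = h x := by
        have h0 := hh x' (by rw [Fin.lt_def]; simp only [x']; omega)
        rw [laplacian_apply, Finset.sum_eq_single x] at h0
        · have hpos := (c.K_irred x (by omega)).2
          rcases mul_eq_zero.1 h0 with h1 | h1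
          · exact absurd h1 hpos.ne'
          · exact sub_eq_zero.1 h1
        · intro w _ hw
          rcases lt_or_ge (x : ℕ) w with hwk | hwk
          · rw [ih' w (by rw [Fin.le_def]; exact hwk), sub_self, mul_zero]
          · have : (w : ℕ) ≠ x := fun e => hw (Fin.ext e)
            rw [c.K_tridiag x' w (by rw [lt_abs]; simp only [x']; push_cast; omega), zero_mul]
        · simp
      rcases eq_or_lt_of_le hz with hzx | hzx
      · rw [Fin.ext hzx]
      · rw [ih' z (by rw [Fin.le_def]; exact hzx), hx']
  exact fun x hx => key (n - y) y (by omega) le_rfl x hx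

theorem eigenvalue_mem_Icc {f : Fin (n + 1) → ℝ} {r : ℝ} (hf : f ≠ 0)
    (h : (1 - c.K) *ᵥ f = r • f) : r ∈ Set.Icc (0 : ℝ) 2 := by
  obtain ⟨x, -, hx⟩ := Finset.exists_max_image Finset.univ (fun x => |f x|) Finset.univ_nonempty
  obtain ⟨x₀, hx₀⟩ := Function.ne_iff.1 hf
  have hpos : 0 < f x * f x := by
    refine mul_self_pos.2 fun h0 => ?_
    have := hx x₀ (Finset.mem_univ _)
    rw [h0, abs_zero] at this
    exact hx₀ (abs_nonpos_iff.1 this)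
  have hb : ∀ y, |f x * f y| ≤ f x * f x := fun y => by
    rw [abs_mul, ← abs_mul_abs_self (f x)]
    exact mul_le_mul_of_nonneg_left (hx y (Finset.mem_univ _)) (abs_nonneg _)
  have heq : r * (f x * f x) = ∑ y, c.K x y * (f x * f x - f x * f y) := by
    have := congrFun h x
    rw [laplacian_apply, Pi.smul_apply, smul_eq_mul] at this
    rw [← mul_assoc, ← this, Finset.sum_mul]
    exact Finset.sum_congr rfl fun y _ => by ring
  constructor
  · refine nonneg_of_mul_nonneg_left ?_ hpos
    rw [heq]
    refine Finset.sum_nonneg fun y _ => mul_nonneg (c.K_nonneg x y) ?_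
    linarith [(abs_le.1 (hb y)).2]
  · refine le_of_mul_le_mul_right ?_ hpos
    rw [heq]
    calc ∑ y, c.K x y * (f x * f x - f x * f y) ≤ ∑ y, c.K x y * (2 * (f x * f x)) :=
          Finset.sum_le_sum fun y _ => mul_le_mul_of_nonneg_left
            (by linarith [(abs_le.1 (hb y)).1]) (c.K_nonneg x y)
      _ = 2 * (f x * f x) := by rw [← Finset.sum_mul, c.K_rowSum, one_mul]

theorem piLow_add (i : Fin (n + 1)) :
    c.piLow i + ∑ x, (if i < x then c.pi x else 0) = 1 := by
  rw [← c.pi_sum, piLow, ← Finset.sum_add_distrib]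
  refine Finset.sum_congr rfl fun x _ => ?_
  rcases le_or_gt x i with h | h
  · simp [h, h.not_gt]
  · simp [h, h.not_ge]

theorem piHigh_add (i : Fin (n + 1)) :
    c.piHigh i + ∑ x, (if x < i then c.pi x else 0) = 1 := by
  rw [← c.pi_sum, piHigh, ← Finset.sum_add_distrib]
  refine Finset.sum_congr rfl fun x _ => ?_
  rcases le_or_gt i x with h | h
  · simp [h, h.not_gt]
  · simp [h, h.not_ge]

theorem piLow_mem (i : Fin (n + 1)) : c.piLow i ∈ Set.Ioc (0 : ℝ) 1 := by
  have h : 0 ≤ ∑ x, (if i < x then c.pi x else 0) :=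
    Finset.sum_nonneg fun x _ => by split_ifs <;> simp [(c.pi_pos x).le]
  refine ⟨?_, by linarith [c.piLow_add i]⟩
  exact Finset.sum_pos' (fun x _ => by split_ifs <;> simp [(c.pi_pos x).le])
    ⟨i, Finset.mem_univ _, by simp [c.pi_pos i]⟩

theorem piHigh_mem (i : Fin (n + 1)) : c.piHigh i ∈ Set.Ioc (0 : ℝ) 1 := by
  have h : 0 ≤ ∑ x, (if x < i then c.pi x else 0) :=
    Finset.sum_nonneg fun x _ => by split_ifs <;> simp [(c.pi_pos x).le]
  refine ⟨?_, by linarith [c.piHigh_add i]⟩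
  exact Finset.sum_pos' (fun x _ => by split_ifs <;> simp [(c.pi_pos x).le])
    ⟨i, Finset.mem_univ _, by simp [c.pi_pos i]⟩

/-- If `g` vanishes outside a set of mass `1 - a` and is there an eigenfunction of `1 - K` with
eigenvalue `r`, then the spectral gap is at most `r / a`. -/
theorem gap_mul_le_of_support {μ : Fin (n + 1) → ℝ}
    {b : Module.Basis (Fin (n + 1)) ℝ (Fin (n + 1) → ℝ)} (hμ : Monotone μ)
    (hb : ∀ j, (1 - c.K) *ᵥ b j = μ j • b j)
    (ho : ∀ j k, ∑ x, c.pi x * (b j x * b k x) = if j = k then 1 else 0)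
    {p : Fin (n + 1) → Prop} [DecidablePred p] {a r : ℝ} (ha : 0 < a)
    (hap : a + ∑ x, (if p x then c.pi x else 0) = 1) {i : Fin (n + 1)} (hi : ¬ p i) (hr : 0 ≤ r)
    {g : Fin (n + 1) → ℝ} (hg : g ≠ 0) (hgp : ∀ x, ¬ p x → g x = 0)
    (hge : ∀ x, p x → ((1 - c.K) *ᵥ g) x = r * g x) (j : Fin (n + 1)) (hj : (j : ℕ) = 1) :
    a * μ j ≤ r := by
  have hcs : (∑ x, c.pi x * g x) ^ 2 ≤ (1 - a) * ∑ x, c.pi x * (g x * g x) := by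
    have h := Finset.sum_mul_sq_le_sq_mul_sq Finset.univ
      (fun x => √(if p x then c.pi x else 0)) (fun x => √(c.pi x) * g x)
    have h1 : ∀ x, √(if p x then c.pi x else 0) * (√(c.pi x) * g x) = c.pi x * g x := fun x => by
      by_cases hx : p x
      · rw [if_pos hx, ← mul_assoc, Real.mul_self_sqrt (c.pi_pos x).le]
      · rw [hgp x hx, mul_zero, mul_zero, mul_zero]
    have h2 : ∀ x, √(if p x then c.pi x else 0) ^ 2 = if p x then c.pi x else 0 := fun x =>
      Real.sq_sqrt (by split_ifs <;> simp [(c.pi_pos x).le])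
    have h3 : ∀ x, (√(c.pi x) * g x) ^ 2 = c.pi x * (g x * g x) := fun x => by
      rw [mul_pow, Real.sq_sqrt (c.pi_pos x).le, sq]
    simp only [h1, h2, h3] at h
    rwa [show ∑ x, (if p x then c.pi x else 0) = 1 - a by linarith] at h
  obtain ⟨W, hW, hW'⟩ := exists_high_subspace hμ hb ho j
  let F : Fin 2 → Fin (n + 1) → ℝ := ![g, 1]
  have hlin : LinearIndependent ℝ F := by
    rw [LinearIndependent.pair_iff]
    intro s t hst
    have ht : t = 0 := by simpa [hgp i hi] using congrFun hst i
    subst ht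
    refine ⟨?_, rfl⟩
    rw [zero_smul, add_zero] at hst
    exact (smul_eq_zero.1 hst).resolve_right hg
  have hle : μ j ≤ r / a := by
    refine le_of_form_bounds (U := Submodule.span ℝ (Set.range F)) c.pi_pos ?_ ?_ hW'
    · rw [hW, finrank_span_eq_card hlin, Fintype.card_fin]
      omega
    · intro f hf
      rw [show Set.range F = {g, 1} by simp [F, Matrix.range_cons, Set.pair_comm],
        Submodule.mem_span_pair] at hf
      obtain ⟨s, t, rfl⟩ := hf
      have hlap : (1 - c.K) *ᵥ (s • g + t • (1 : Fin (n + 1) → ℝ)) = s • ((1 - c.K) *ᵥ g) := by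
        rw [mulVec_add, mulVec_smul, mulVec_smul, laplacian_one, smul_zero, add_zero]
      have hform : ∑ x, c.pi x * ((s • g + t • (1 : Fin (n + 1) → ℝ)) x *
          ((1 - c.K) *ᵥ (s • g + t • (1 : Fin (n + 1) → ℝ))) x) =
          s ^ 2 * (r * ∑ x, c.pi x * (g x * g x)) := by
        rw [hlap]
        have hgg : ∀ x, g x * ((1 - c.K) *ᵥ g) x = r * (g x * g x) := fun x => by
          by_cases hx : p x
          · rw [hge x hx]
            ring
          · rw [hgp x hx]
            ring
        have : ∀ x, c.pi x * ((s • g + t • (1 : Fin (n + 1) → ℝ)) x * (s • ((1 - c.K) *ᵥ g)) x) =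
            s ^ 2 * (r * (c.pi x * (g x * g x))) + s * t * (c.pi x * ((1 - c.K) *ᵥ g) x) := by
          intro x
          simp only [Pi.add_apply, Pi.smul_apply, Pi.one_apply, smul_eq_mul]
          linear_combination c.pi x * s ^ 2 * hgg x
        simp only [this]
        rw [Finset.sum_add_distrib, ← Finset.mul_sum, ← Finset.mul_sum, ← Finset.mul_sum,
          sum_pi_mul_laplacian, mul_zero, add_zero]
      have hnorm : ∑ x, c.pi x * ((s • g + t • (1 : Fin (n + 1) → ℝ)) x *
          (s • g + t • (1 : Fin (n + 1) → ℝ)) x) =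
          s ^ 2 * (∑ x, c.pi x * (g x * g x)) + 2 * s * t * (∑ x, c.pi x * g x) + t ^ 2 := by
        have : ∀ x, c.pi x * ((s • g + t • (1 : Fin (n + 1) → ℝ)) x *
            (s • g + t • (1 : Fin (n + 1) → ℝ)) x) =
            s ^ 2 * (c.pi x * (g x * g x)) + 2 * s * t * (c.pi x * g x) + t ^ 2 * c.pi x := by
          intro x
          simp only [Pi.add_apply, Pi.smul_apply, Pi.one_apply, smul_eq_mul]
          ring
        simp only [this]
        rw [Finset.sum_add_distrib, Finset.sum_add_distrib, ← Finset.mul_sum, ← Finset.mul_sum,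
          ← Finset.mul_sum, c.pi_sum, mul_one]
      rw [hform, hnorm]
      set A := ∑ x, c.pi x * (g x * g x)
      set B := ∑ x, c.pi x * g x
      have h1 : a * (s ^ 2 * A) ≤ s ^ 2 * A + 2 * s * t * B + t ^ 2 := by
        nlinarith [sq_nonneg (s * B + t), mul_le_mul_of_nonneg_left hcs (sq_nonneg s)]
      calc s ^ 2 * (r * A) = r / a * (a * (s ^ 2 * A)) := by
            field_simp
        _ ≤ _ := mul_le_mul_of_nonneg_left h1 (by positivity)
  rw [mul_comm]
  exact (le_div_iff₀ ha).1 hle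

/-- The smallest Dirichlet eigenvalue dominates `a(i)` times the spectral gap. -/
theorem min_mul_gap_le {μ : Fin (n + 1) → ℝ}
    {b : Module.Basis (Fin (n + 1)) ℝ (Fin (n + 1) → ℝ)} (hμ : Monotone μ)
    (hb : ∀ j, (1 - c.K) *ᵥ b j = μ j • b j)
    (ho : ∀ j k, ∑ x, c.pi x * (b j x * b k x) = if j = k then 1 else 0) (i : Fin (n + 1))
    {r : ℝ} (hr : 0 ≤ r) {f : Fin n → ℝ} (hf : f ≠ 0)
    (hfr : (1 - c.K).submatrix i.succAbove i.succAbove *ᵥ f = r • f)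
    (j : Fin (n + 1)) (hj : (j : ℕ) = 1) :
    min (c.piLow i) (c.piHigh i) * μ j ≤ r := by
  have hμ0 : 0 ≤ μ j := (c.eigenvalue_mem_Icc (b.ne_zero j) (hb j)).1
  set e := extendZero i f with he
  have hei : e i = 0 := extendZero_same i f
  have hee : ∀ x, x ≠ i → ((1 - c.K) *ᵥ e) x = r * e x := by
    intro x hx
    obtain ⟨y, rfl⟩ := Fin.exists_succAbove_eq hx
    rw [he, mulVec_extendZero_succAbove, hfr]
    simp
  have htri : ∀ x y : Fin (n + 1), x < i ∧ i < y ∨ y < i ∧ i < x → (1 - c.K) x y = 0 := by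
    intro x y hxy
    simp only [Fin.lt_def] at hxy
    rw [Matrix.sub_apply, Matrix.one_apply_ne (fun h => by rw [h] at hxy; omega),
      c.K_tridiag x y (by rw [lt_abs]; omega), sub_zero]
  obtain ⟨a₀, ha₀⟩ := Function.ne_iff.1 hf
  have hsub : ∀ {p : Fin (n + 1) → Prop} [DecidablePred p],
      (∀ x, p x → x ≠ i) → (∀ x y, p x → ¬ p y → y ≠ i → (1 - c.K) x y = 0) →
      ∀ x, p x → ((1 - c.K) *ᵥ fun y => if p y then e y else 0) x =
        r * (if p x then e x else 0) := by
    intro p _ hpi hp x hx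
    rw [if_pos hx, ← hee x (hpi x hx)]
    simp only [mulVec, dotProduct]
    refine Finset.sum_congr rfl fun y _ => ?_
    by_cases hy : p y
    · simp [hy]
    · by_cases hyi : y = i
      · simp [hyi, hei]
      · rw [hp x y hx hy hyi, zero_mul, zero_mul]
  rcases lt_or_gt_of_ne (Fin.succAbove_ne i a₀) with hlt | hlt
  · refine (mul_le_mul_of_nonneg_right (min_le_right _ _) hμ0).trans ?_
    refine c.gap_mul_le_of_support hμ hb ho (p := fun x => x < i) (i := i)
      (g := fun x => if x < i then e x else 0) (c.piHigh_mem i).1 (c.piHigh_add i)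
      (lt_irrefl i) hr ?_ (fun x hx => if_neg hx) ?_ j hj
    · refine Function.ne_iff.2 ⟨i.succAbove a₀, ?_⟩
      simpa [hlt, he] using ha₀
    · exact hsub (fun x hx => hx.ne) fun x y hx hy hyi =>
        htri x y (Or.inl ⟨hx, lt_of_le_of_ne (not_lt.1 hy) (Ne.symm hyi)⟩)
  · refine (mul_le_mul_of_nonneg_right (min_le_left _ _) hμ0).trans ?_
    refine c.gap_mul_le_of_support hμ hb ho (p := fun x => i < x) (i := i)
      (g := fun x => if i < x then e x else 0) (c.piLow_mem i).1 (c.piLow_add i)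
      (lt_irrefl i) hr ?_ (fun x hx => if_neg hx) ?_ j hj
    · refine Function.ne_iff.2 ⟨i.succAbove a₀, ?_⟩
      simpa [hlt, he] using ha₀
    · exact hsub (fun x hx => (ne_of_lt hx).symm) fun x y hx hy hyi =>
        htri x y (Or.inr ⟨lt_of_le_of_ne (not_lt.1 hy) hyi, hx⟩)

end BDChain

/-! ### Hitting times of birth and death chains -/

/-- The variance identity behind the sum of the squared inverse Dirichlet eigenvalues. -/
theorem two_mul_sum_sub_sq_eq {ι : Type*} (s : Finset ι) {H : ι → ι → ℝ}
    (hH : ∀ x ∈ s, ∀ y ∈ s, H x y = H y y ∨ H y x = H x x) :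
    2 * ∑ y ∈ s, ∑ x ∈ s, H y y * H y x - (∑ y ∈ s, H y y) ^ 2 =
      ∑ x ∈ s, ∑ y ∈ s, H x y * H y x := by
  have hsymm : ∑ y ∈ s, ∑ x ∈ s, H y y * H y x = ∑ y ∈ s, ∑ x ∈ s, H x x * H x y :=
    Finset.sum_comm
  have hsq : (∑ y ∈ s, H y y) ^ 2 = ∑ y ∈ s, ∑ x ∈ s, H y y * H x x := by
    rw [sq, Finset.sum_mul_sum]
  rw [two_mul]
  nth_rewrite 2 [hsymm]
  rw [hsq, ← Finset.sum_add_distrib, ← Finset.sum_sub_distrib]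
  refine Finset.sum_congr rfl fun y hy => ?_
  rw [← Finset.sum_add_distrib, ← Finset.sum_sub_distrib]
  refine Finset.sum_congr rfl fun x hx => ?_
  rcases hH x hx y hy with h | h <;> rw [h] <;> ring

namespace BDChain

variable {n : ℕ} (c : BDChain n)

theorem killed_nonneg (i x y : Fin (n + 1)) : 0 ≤ c.killed i x y := by
  simp only [killed, of_apply]
  split_ifs
  exacts [le_rfl, c.K_nonneg x y]

theorem killed_mulVec (i : Fin (n + 1)) {f : Fin (n + 1) → ℝ} (hf : f i = 0) (x : Fin (n + 1)) :
    (c.killed i *ᵥ f) x = if x = i then 0 else f x - ((1 - c.K) *ᵥ f) x := by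
  rw [sub_mulVec, one_mulVec, Pi.sub_apply, sub_sub_cancel]
  by_cases hx : x = i
  · simp [mulVec, dotProduct, killed, hx]
  · rw [if_neg hx]
    simp only [mulVec, dotProduct]
    refine Finset.sum_congr rfl fun y _ => ?_
    by_cases hy : y = i
    · simp [hy, hf]
    · simp [killed, hx, hy]

theorem hitSurv_eq (i x : Fin (n + 1)) (m : ℕ) :
    c.hitSurv i x m = (c.killed i ^ m *ᵥ fun y => if y = i then 0 else 1) x := by
  by_cases hx : x = i
  · rw [hitSurv, if_pos hx]
    cases m with
    | zero => simp [hx]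
    | succ m =>
      rw [pow_succ', ← mulVec_mulVec]
      simp [mulVec, dotProduct, killed, hx]
  · rw [hitSurv, if_neg hx]
    simp only [mulVec, dotProduct]
    refine Finset.sum_congr rfl fun y _ => ?_
    by_cases hy : y = i
    · rw [if_pos hy, mul_zero, hy]
      cases m with
      | zero => simp [hx]
      | succ m =>
        rw [pow_succ, Matrix.mul_apply]
        simp [killed]
    · simp [hy]

theorem hitSurv_nonneg (i x : Fin (n + 1)) (m : ℕ) : 0 ≤ c.hitSurv i x m := by
  rw [hitSurv_eq]
  refine (abs_nonneg _).trans (abs_pow_mulVec_le (f := 0) (c.killed_nonneg i) (fun y => ?_) m x)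
  split_ifs <;> simp

/-- The minimum principle. -/
theorem nonneg_of_laplacian_eq_one {i : Fin (n + 1)} {u : Fin (n + 1) → ℝ} (hi : u i = 0)
    (hu : ∀ x, x ≠ i → ((1 - c.K) *ᵥ u) x = 1) (x : Fin (n + 1)) : 0 ≤ u x := by
  obtain ⟨z, -, hz⟩ := Finset.exists_min_image Finset.univ u Finset.univ_nonempty
  refine le_trans ?_ (hz x (Finset.mem_univ _))
  by_cases hzi : z = i
  · rw [hzi, hi]
  · have h1 := hu z hzi
    rw [laplacian_apply] at h1
    have : ∑ y, c.K z y * (u z - u y) ≤ 0 := Finset.sum_nonpos fun y _ =>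
      mul_nonpos_of_nonneg_of_nonpos (c.K_nonneg z y) (sub_nonpos.2 (hz y (Finset.mem_univ _)))
    linarith

/-- The first two moments of the hitting time of `i` solve Poisson equations. -/
theorem hasSum_hitSurv {i : Fin (n + 1)} {u v : Fin (n + 1) → ℝ} (hui : u i = 0) (hvi : v i = 0)
    (hu : ∀ x, x ≠ i → ((1 - c.K) *ᵥ u) x = 1)
    (hv : ∀ x, x ≠ i → ((1 - c.K) *ᵥ v) x = u x) (x : Fin (n + 1)) :
    HasSum (c.hitSurv i x) (u x) ∧
      HasSum (fun m : ℕ => ((m : ℝ) + 1) * c.hitSurv i x m) (v x) := by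
  have hfun : c.hitSurv i x = fun m => c.hitSurv i x m := rfl
  rw [hfun]
  simp only [hitSurv_eq]
  let C : ℝ := 1 + ∑ y, (|u y| + |v y|)
  have hCu : ∀ y, |u y| + |v y| ≤ C := fun y => by
    have := Finset.single_le_sum (f := fun y => |u y| + |v y|)
      (fun y _ => by positivity) (Finset.mem_univ y)
    simp only [C]
    linarith
  have hC : 1 ≤ C := le_add_of_nonneg_right (Finset.sum_nonneg fun y _ => by positivity)
  refine hasSum_pow_mulVec (c.killed_nonneg i) hC (fun y => ?_)
    (c.nonneg_of_laplacian_eq_one hui hu) ?_ ?_ (fun y => ?_) (fun y => ?_) x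
  · split_ifs <;> simp
  · ext y
    rw [Pi.add_apply, killed_mulVec _ _ hui]
    by_cases hy : y = i
    · simp [hy, hui]
    · simp [hy, hu]
  · ext y
    rw [Pi.add_apply, killed_mulVec _ _ hvi]
    by_cases hy : y = i
    · simp [hy, hui, hvi]
    · simp [hy, hv]
  · by_cases hy : y = i
    · simp [hy, hui]
    · rw [if_neg hy]
      linarith [hCu y, le_abs_self (u y), abs_nonneg (v y)]
  · by_cases hy : y = i
    · simp [hy, hvi]
    · rw [if_neg hy]
      linarith [hCu y, abs_nonneg (u y)]

theorem hit_moments {i : Fin (n + 1)} {u v : Fin (n + 1) → ℝ} (hui : u i = 0) (hvi : v i = 0)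
    (hu : ∀ x, x ≠ i → ((1 - c.K) *ᵥ u) x = 1)
    (hv : ∀ x, x ≠ i → ((1 - c.K) *ᵥ v) x = u x) (x : Fin (n + 1)) :
    c.hitMean i x = u x ∧ c.hitMeanC i x = u x ∧ c.hitVar i x = 2 * v x - u x - u x ^ 2 ∧
      c.hitVarC i x = 2 * v x - u x ^ 2 := by
  obtain ⟨h1, h2⟩ := c.hasSum_hitSurv hui hvi hu hv x
  have hmean : c.hitMean i x = u x := h1.tsum_eq
  have hmeanC : c.hitMeanC i x = u x := integral_poissonized (c.hitSurv_nonneg i x) h1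
  refine ⟨hmean, hmeanC, ?_, ?_⟩
  · rw [hitVar, hmean]
    have h3 := (h2.mul_left 2).sub h1
    have : ∀ m : ℕ, 2 * (((m : ℝ) + 1) * c.hitSurv i x m) - c.hitSurv i x m =
        (2 * (m : ℝ) + 1) * c.hitSurv i x m := fun m => by ring
    simp only [this] at h3
    rw [h3.tsum_eq]
  · rw [hitVarC, hmeanC]
    congr 1
    exact integral_mul_poissonized (c.hitSurv_nonneg i x) h2

/-- Sums over both ends of the moments of the hitting time of `i`, in terms of the Green
function `H` of the chain killed at `i`. -/
theorem hit_moments_green {i : Fin (n + 1)} {H : Fin (n + 1) → Fin (n + 1) → ℝ}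
    (hi : ∀ y, H i y = 0)
    (hH : ∀ x, x ≠ i → ∀ y, ((1 - c.K) *ᵥ fun z => H z y) x = if x = y then 1 else 0) :
    c.hitMean i 0 + c.hitMean i (Fin.last n) = ∑ x, H x x ∧
    c.hitMeanC i 0 + c.hitMeanC i (Fin.last n) = ∑ x, H x x ∧
    c.hitVar i 0 + c.hitVar i (Fin.last n) = ∑ x, ∑ y, H x y * H y x - ∑ x, H x x ∧
    c.hitVarC i 0 + c.hitVarC i (Fin.last n) = ∑ x, ∑ y, H x y * H y x := by
  let u : Fin (n + 1) → ℝ := fun x => ∑ y, H x y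
  let v : Fin (n + 1) → ℝ := fun x => ∑ y, H x y * u y
  have hlin : ∀ (g : Fin (n + 1) → ℝ) (x), x ≠ i →
      ((1 - c.K) *ᵥ fun z => ∑ y, H z y * g y) x = g x := by
    intro g x hx
    have : (fun z => ∑ y, H z y * g y) = ∑ y, g y • fun z => H z y := by
      ext z
      simp [mul_comm]
    rw [this, mulVec_sum, Finset.sum_apply]
    simp only [mulVec_smul, Pi.smul_apply, hH x hx, smul_eq_mul]
    simp
  have hmom := c.hit_moments (i := i) (u := u) (v := v) (by simp [u, hi]) (by simp [v, hi])
    (fun x hx => by simpa [u] using hlin (fun _ => 1) x hx) (fun x hx => hlin u x hx)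
  obtain ⟨m0, mC0, v0, vC0⟩ := hmom 0
  obtain ⟨m1, mC1, v1, vC1⟩ := hmom (Fin.last n)
  have hleft : ∀ x y, x ≤ y → y ≤ i → H x y = H y y := by
    intro x y hxy hyi
    refine c.eq_of_harmonic_left (h := fun z => H z y) (y := y) (fun z hz => ?_) x hxy
    rw [hH z (hz.trans_le hyi).ne, if_neg hz.ne]
  have hright : ∀ x y, y ≤ x → i ≤ y → H x y = H y y := by
    intro x y hxy hyi
    refine c.eq_of_harmonic_right (h := fun z => H z y) (y := y) (fun z hz => ?_) x hxy
    rw [hH z (hyi.trans_lt hz).ne', if_neg hz.ne']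
  have hcross1 : ∀ x y, x ≤ i → i ≤ y → H x y = 0 := by
    intro x y hx hy
    rw [← hi y]
    refine c.eq_of_harmonic_left (h := fun z => H z y) (y := i) (fun z hz => ?_) x hx
    rw [hH z hz.ne, if_neg (hz.trans_le hy).ne]
  have hcross2 : ∀ x y, i ≤ x → y ≤ i → H x y = 0 := by
    intro x y hx hy
    rw [← hi y]
    refine c.eq_of_harmonic_right (h := fun z => H z y) (y := i) (fun z hz => ?_) x hx
    rw [hH z hz.ne', if_neg (hy.trans_lt hz).ne']
  let s : Finset (Fin (n + 1)) := Finset.univ.filter (· < i)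
  have hs : ∀ {x}, x ∈ s ↔ x < i := by simp [s]
  have hsc : ∀ {x}, x ∈ sᶜ ↔ i ≤ x := by simp [s]
  have hsplit : ∀ f : Fin (n + 1) → ℝ, ∑ x, f x = ∑ x ∈ s, f x + ∑ x ∈ sᶜ, f x :=
    fun f => (Finset.sum_add_sum_compl s f).symm
  have hl0 : ∀ g : Fin (n + 1) → ℝ, ∑ y, H 0 y * g y = ∑ y ∈ s, H y y * g y := by
    intro g
    rw [hsplit, Finset.sum_eq_zero (s := sᶜ), add_zero]
    · exact Finset.sum_congr rfl fun y hy => by rw [hleft 0 y (Fin.zero_le _) (hs.1 hy).le]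
    · intro y hy
      rw [hcross1 0 y (Fin.zero_le _) (hsc.1 hy), zero_mul]
  have hl1 : ∀ g : Fin (n + 1) → ℝ, ∑ y, H (Fin.last n) y * g y = ∑ y ∈ sᶜ, H y y * g y := by
    intro g
    rw [hsplit, Finset.sum_eq_zero (s := s), zero_add]
    · exact Finset.sum_congr rfl fun y hy => by rw [hright _ y (Fin.le_last _) (hsc.1 hy)]
    · intro y hy
      rw [hcross2 _ y (Fin.le_last _) (hs.1 hy).le, zero_mul]
  have hu0 : u 0 = ∑ y ∈ s, H y y := by simpa [u] using hl0 fun _ => 1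
  have hu1 : u (Fin.last n) = ∑ y ∈ sᶜ, H y y := by simpa [u] using hl1 fun _ => 1
  have hus : ∀ y ∈ s, u y = ∑ x ∈ s, H y x := fun y hy => by
    simp only [u]
    rw [hsplit, Finset.sum_eq_zero (s := sᶜ), add_zero]
    exact fun x hx => hcross1 _ _ (hs.1 hy).le (hsc.1 hx)
  have husc : ∀ y ∈ sᶜ, u y = ∑ x ∈ sᶜ, H y x := fun y hy => by
    simp only [u]
    rw [hsplit, Finset.sum_eq_zero (s := s), zero_add]
    exact fun x hx => hcross2 _ _ (hsc.1 hy) (hs.1 hx).le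
  have hv0 : v 0 = ∑ y ∈ s, ∑ x ∈ s, H y y * H y x := by
    simp only [v]
    rw [hl0]
    exact Finset.sum_congr rfl fun y hy => by rw [hus y hy, Finset.mul_sum]
  have hv1 : v (Fin.last n) = ∑ y ∈ sᶜ, ∑ x ∈ sᶜ, H y y * H y x := by
    simp only [v]
    rw [hl1]
    exact Finset.sum_congr rfl fun y hy => by rw [husc y hy, Finset.mul_sum]
  have hq0 := two_mul_sum_sub_sq_eq s (H := H) fun x hx y hy => by
    rcases le_total x y with h | h
    · exact Or.inl (hleft x y h (hs.1 hy).le)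
    · exact Or.inr (hleft y x h (hs.1 hx).le)
  have hq1 := two_mul_sum_sub_sq_eq sᶜ (H := H) fun x hx y hy => by
    rcases le_total x y with h | h
    · exact Or.inr (hright y x h (hsc.1 hx))
    · exact Or.inl (hright x y h (hsc.1 hy))
  have hmean : u 0 + u (Fin.last n) = ∑ x, H x x := by rw [hu0, hu1, hsplit]
  have hvar : (2 * v 0 - u 0 ^ 2) + (2 * v (Fin.last n) - u (Fin.last n) ^ 2) =
      ∑ x, ∑ y, H x y * H y x := by
    rw [hv0, hv1, hu0, hu1, hq0, hq1, hsplit]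
    congr 1
    · refine Finset.sum_congr rfl fun x hx => ?_
      rw [hsplit, left_eq_add]
      exact Finset.sum_eq_zero fun y hy => by
        rw [hcross1 x y (hs.1 hx).le (hsc.1 hy), zero_mul]
    · refine Finset.sum_congr rfl fun x hx => ?_
      rw [hsplit, right_eq_add]
      exact Finset.sum_eq_zero fun y hy => by
        rw [hcross2 x y (hsc.1 hx) (hs.1 hy).le, zero_mul]
  refine ⟨by rw [m0, m1, hmean], by rw [mC0, mC1, hmean], ?_, by rw [vC0, vC1, hvar]⟩
  rw [v0, v1, ← hvar, ← hmean]
  ring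

theorem hit_moments_trace {i : Fin (n + 1)} {G : Matrix (Fin n) (Fin n) ℝ}
    (hG : (1 - c.K).submatrix i.succAbove i.succAbove * G = 1) :
    c.hitMean i 0 + c.hitMean i (Fin.last n) = G.trace ∧
    c.hitMeanC i 0 + c.hitMeanC i (Fin.last n) = G.trace ∧
    c.hitVar i 0 + c.hitVar i (Fin.last n) = (G * G).trace - G.trace ∧
    c.hitVarC i 0 + c.hitVarC i (Fin.last n) = (G * G).trace := by
  let H : Fin (n + 1) → Fin (n + 1) → ℝ := fun x y =>
    extendZero i (fun b => extendZero i (fun a => G a b) x) y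
  have hi' : ∀ x, H x i = 0 := fun x => by simp [H]
  have hHs : ∀ x b, H x (i.succAbove b) = extendZero i (fun a => G a b) x := fun x b => by simp [H]
  have hHss : ∀ a b, H (i.succAbove a) (i.succAbove b) = G a b := fun a b => by simp [H]
  have hi : ∀ y, H i y = 0 := fun y => by
    refine Fin.succAboveCases i ?_ (fun b => ?_) y
    · exact hi' i
    · simp [hHs]
  have h := c.hit_moments_green hi fun x hx y => by
    obtain ⟨a, rfl⟩ := Fin.exists_succAbove_eq hx
    refine Fin.succAboveCases i ?_ (fun b => ?_) y
    · simp only [hi', if_neg (Fin.succAbove_ne i a)]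
      exact congrFun (mulVec_zero (1 - c.K)) _
    · simp only [hHs, mulVec_extendZero_succAbove]
      have := congrFun (congrFun hG a) b
      rw [Matrix.one_apply] at this
      simp only [Fin.succAbove_right_inj]
      rw [← this]
      rfl
  have ht : ∑ x, H x x = G.trace := by
    simp [Fin.sum_univ_succAbove _ i, hi, hHss, Matrix.trace]
  have ht2 : ∑ x, ∑ y, H x y * H y x = (G * G).trace := by
    simp [Fin.sum_univ_succAbove _ i, hi, hHss, Matrix.trace, Matrix.mul_apply]
  rwa [ht, ht2] at h

end BDChain

/-! ### The Dirichlet spectrum and the main theorem -/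

namespace BDChain

variable {n : ℕ} (c : BDChain n)

/-- The moments of the hitting times in terms of the spectrum of the killed chain. -/
theorem hit_moments_spectral {i : Fin (n + 1)} {γ : Fin n → ℝ}
    {d : Module.Basis (Fin n) ℝ (Fin n → ℝ)} (hγ : ∀ j, γ j ≠ 0)
    (hd : ∀ j, (1 - c.K).submatrix i.succAbove i.succAbove *ᵥ d j = γ j • d j) :
    c.hitMean i 0 + c.hitMean i (Fin.last n) = ∑ j, (γ j)⁻¹ ∧
    c.hitMeanC i 0 + c.hitMeanC i (Fin.last n) = ∑ j, (γ j)⁻¹ ∧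
    c.hitVar i 0 + c.hitVar i (Fin.last n) = ∑ j, (γ j ^ 2)⁻¹ - ∑ j, (γ j)⁻¹ ∧
    c.hitVarC i 0 + c.hitVarC i (Fin.last n) = ∑ j, (γ j ^ 2)⁻¹ := by
  set N := (1 - c.K).submatrix i.succAbove i.succAbove with hN
  have hdet : IsUnit N.det := by
    rw [det_eq_of_eigenbasis hd]
    exact (Finset.prod_ne_zero_iff.2 fun j _ => hγ j).isUnit
  have h := c.hit_moments_trace (Matrix.mul_nonsing_inv N hdet)
  have hinv : ∀ j, N⁻¹ *ᵥ d j = (γ j)⁻¹ • d j := fun j => by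
    rw [eq_inv_smul_iff₀ (hγ j), ← mulVec_smul, ← hd, mulVec_mulVec, Matrix.nonsing_inv_mul N hdet,
      one_mulVec]
  have hinv2 : ∀ j, (N⁻¹ * N⁻¹) *ᵥ d j = (γ j ^ 2)⁻¹ • d j := fun j => by
    rw [← mulVec_mulVec, hinv, mulVec_smul, hinv, smul_smul, sq, mul_inv]
  rwa [trace_eq_of_eigenbasis hinv, trace_eq_of_eigenbasis hinv2] at h

/-- The Dirichlet spectrum at `i` interlaces with the nonzero spectrum `lam` of `1 - K`, and its
bottom is at least `a(i)` times the spectral gap. -/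
theorem exists_dirichlet_spectrum {k : ℕ} (c : BDChain (k + 1)) {lam : Fin (k + 1) → ℝ}
    (hmono : Monotone lam)
    (hlam : (1 - c.K).charpoly = Polynomial.X * ∏ j, (Polynomial.X - Polynomial.C (lam j)))
    (hne : ∀ j, lam j ≠ 0) (i : Fin (k + 1 + 1)) :
    ∃ (γ : Fin (k + 1) → ℝ) (d : Module.Basis (Fin (k + 1)) ℝ (Fin (k + 1) → ℝ)),
      (∀ j, (1 - c.K).submatrix i.succAbove i.succAbove *ᵥ d j = γ j • d j) ∧
      (∀ j, 0 < γ j) ∧ (∀ j, γ j ≤ lam j) ∧ (∀ j : Fin k, lam j.castSucc ≤ γ j.succ) ∧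
      min (c.piLow i) (c.piHigh i) * lam 0 ≤ γ 0 ∧ ∀ j, lam j ∈ Set.Ioc (0 : ℝ) 2 := by
  obtain ⟨μ, b, hμ, hb, ho⟩ := exists_weighted_eigenbasis c.pi_pos c.pi_mul_one_sub_K_comm
  obtain ⟨γ, d, hγ, hd, hdo⟩ := exists_weighted_eigenbasis
    (M := (1 - c.K).submatrix i.succAbove i.succAbove) (w := fun a => c.pi (i.succAbove a))
    (fun a => c.pi_pos _) (fun a a' => c.pi_mul_one_sub_K_comm _ _)
  have hμmem : ∀ j, μ j ∈ Set.Icc (0 : ℝ) 2 := fun j =>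
    c.eigenvalue_mem_Icc (b.ne_zero j) (hb j)
  have hprod := charpoly_eq_of_eigenbasis hb
  rw [hlam] at hprod
  have hmem : ∀ j, lam j ∈ Set.Ioc (0 : ℝ) 2 := fun j => by
    have h := congrArg (Polynomial.eval (lam j)) hprod
    rw [Polynomial.eval_mul, Polynomial.eval_prod, Polynomial.eval_prod,
      Finset.prod_eq_zero (Finset.mem_univ j) (by simp), mul_zero, eq_comm,
      Finset.prod_eq_zero_iff] at h
    obtain ⟨l, -, hl⟩ := h
    rw [Polynomial.eval_sub, Polynomial.eval_X, Polynomial.eval_C, sub_eq_zero] at hl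
    rw [hl]
    exact ⟨lt_of_le_of_ne (hμmem l).1 fun h0 => hne j (hl.trans h0.symm), (hμmem l).2⟩
  have hμeq : μ = Fin.cons 0 lam := by
    refine eq_of_monotone_of_prod_X_sub_C_eq hμ ?_ ?_
    · intro x y hxy
      induction x using Fin.cases with
      | zero =>
        induction y using Fin.cases with
        | zero => simp
        | succ y => simpa using (hmem y).1.le
      | succ x =>
        induction y using Fin.cases with
        | zero => simp at hxy
        | succ y => simpa using hmono (Fin.succ_le_succ_iff.1 hxy)
    · rw [← hprod, Fin.prod_univ_succ (n := k + 1)]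
      simp
  have hμs : ∀ j : Fin (k + 1), μ j.succ = lam j := fun j => by rw [hμeq, Fin.cons_succ]
  have hint := cauchy_interlacing c.pi_pos i hμ hb ho hγ hd hdo
  have hγ0 : 0 ≤ γ 0 := (hμmem _).1.trans (hint 0).1
  have hgap : min (c.piLow i) (c.piHigh i) * lam 0 ≤ γ 0 := by
    rw [← hμs]
    exact c.min_mul_gap_le hμ hb ho i hγ0 (d.ne_zero 0) (hd 0) _ rfl
  have ha : 0 < min (c.piLow i) (c.piHigh i) := lt_min (c.piLow_mem i).1 (c.piHigh_mem i).1
  refine ⟨γ, d, hd, fun j => ?_, fun j => ?_, fun j => ?_, hgap, hmem⟩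
  · exact ((mul_pos ha (hmem 0).1).trans_le hgap).trans_le (hγ (Fin.zero_le j))
  · rw [← hμs]
    exact (hint j).2
  · rw [← hμs]
    exact (hint j.succ).1

end BDChain

theorem antitoneOn_inv_sq_sub_inv :
    AntitoneOn (fun x : ℝ => (x ^ 2)⁻¹ - x⁻¹) (Set.Ioc 0 2) := by
  intro x hx y hy hxy
  have h1 : y⁻¹ ≤ x⁻¹ := inv_anti₀ hx.1 hxy
  have h2 : (2 : ℝ)⁻¹ ≤ y⁻¹ := inv_anti₀ hy.1 hy.2
  simp only [← inv_pow]
  nlinarith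

/-- Corollary `c-sep`.  With `λ_1,…,λ_n` the non-zero eigenvalues of
`I − K`, `t = Σ 1/λ_i`, `σ² = Σ 1/λ_i²`, `ρ² = σ² − t` and `λ = min_i λ_i`, for every state
`i` (with `a(i) = min{π([0,i]), π([i,n])}`):
`t ≤ E_0 τ̃_i + E_n τ̃_i = E_0 τ_i + E_n τ_i ≤ t + 4/(a(i)λ)`,
`σ² ≤ Var_0 τ̃_i + Var_n τ̃_i ≤ 17σ²/a(i)²`, and
`ρ² ≤ Var_0 τ_i + Var_n τ_i ≤ ρ² + 17/(a(i)²λ²)`. -/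
theorem birth_death_hitting_time_spectral_bounds
    {n : ℕ} (c : BDChain n) (lam : Fin n → ℝ)
    (hlam : Matrix.charpoly (1 - c.K) =
      Polynomial.X * ∏ j, (Polynomial.X - Polynomial.C (lam j)))
    (hlam_ne : ∀ j, lam j ≠ 0)
    (lmin : ℝ) (hlmin : IsLeast (Set.range lam) lmin) :
    ∀ i : Fin (n + 1),
      (∑ j, (lam j)⁻¹) ≤ c.hitMeanC i 0 + c.hitMeanC i (Fin.last n) ∧
      c.hitMeanC i 0 + c.hitMeanC i (Fin.last n) = c.hitMean i 0 + c.hitMean i (Fin.last n) ∧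
      c.hitMeanC i 0 + c.hitMeanC i (Fin.last n) ≤
        (∑ j, (lam j)⁻¹) + 4 / (min (c.piLow i) (c.piHigh i) * lmin) ∧
      (∑ j, ((lam j) ^ 2)⁻¹) ≤ c.hitVarC i 0 + c.hitVarC i (Fin.last n) ∧
      c.hitVarC i 0 + c.hitVarC i (Fin.last n) ≤
        17 * (∑ j, ((lam j) ^ 2)⁻¹) / (min (c.piLow i) (c.piHigh i)) ^ 2 ∧
      ((∑ j, ((lam j) ^ 2)⁻¹) - (∑ j, (lam j)⁻¹)) ≤ c.hitVar i 0 + c.hitVar i (Fin.last n) ∧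
      c.hitVar i 0 + c.hitVar i (Fin.last n) ≤
        ((∑ j, ((lam j) ^ 2)⁻¹) - (∑ j, (lam j)⁻¹)) +
          17 / ((min (c.piLow i) (c.piHigh i)) ^ 2 * lmin ^ 2) := by
  intro i
  cases n with
  | zero =>
    obtain ⟨⟨j, -⟩, -⟩ := hlmin
    exact j.elim0
  | succ k =>
    let σ := Tuple.sort lam
    have hmono : Monotone (lam ∘ σ) := Tuple.monotone_sort lam
    have hmin : lmin = (lam ∘ σ) 0 := by
      obtain ⟨⟨j, rfl⟩, hj⟩ := hlmin
      refine le_antisymm (hj ⟨σ 0, rfl⟩) ?_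
      rw [← σ.apply_symm_apply j]
      exact hmono (Fin.zero_le (σ.symm j))
    have hsum : ∀ g : ℝ → ℝ, ∑ j, g (lam j) = ∑ j, g ((lam ∘ σ) j) := fun g =>
      (Equiv.sum_comp σ fun j => g (lam j)).symm
    have hprod : ∏ j, (Polynomial.X - Polynomial.C (lam j)) =
        ∏ j, (Polynomial.X - Polynomial.C ((lam ∘ σ) j)) :=
      (Equiv.prod_comp σ fun j => Polynomial.X - Polynomial.C (lam j)).symm
    rw [hprod] at hlam
    rw [hmin, hsum fun x => x⁻¹, hsum fun x => (x ^ 2)⁻¹]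
    obtain ⟨γ, d, hd, hγ0, hγle, hγge, hgap, hmem⟩ :=
      c.exists_dirichlet_spectrum hmono hlam (fun j => hlam_ne (σ j)) i
    generalize lam ∘ σ = l at *
    obtain ⟨m1, m2, m3, m4⟩ := c.hit_moments_spectral (fun j => (hγ0 j).ne') hd
    have ha0 : 0 < min (c.piLow i) (c.piHigh i) := lt_min (c.piLow_mem i).1 (c.piHigh_mem i).1
    have ha1 : min (c.piLow i) (c.piHigh i) ≤ 1 := (min_le_left _ _).trans (c.piLow_mem i).2
    set a := min (c.piLow i) (c.piHigh i)
    have hl2 : ∀ j, l j ≤ 2 := fun j => (hmem j).2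
    have hl0 : ∀ j, 0 < l j := fun j => (hmem j).1
    have hb1 := sum_interlaced_bounds (g := fun x => x⁻¹)
      (fun x hx y _ hxy => inv_anti₀ hx.1 hxy) hl2 hγ0 hγle hγge
    have hb2 := sum_interlaced_bounds (g := fun x => (x ^ 2)⁻¹)
      (fun x hx y _ hxy => inv_anti₀ (pow_pos hx.1 2) (pow_le_pow_left₀ hx.1.le hxy 2))
      hl2 hγ0 hγle hγge
    have hb3 := sum_interlaced_bounds antitoneOn_inv_sq_sub_inv hl2 hγ0 hγle hγge
    simp only [Finset.sum_sub_distrib] at hb3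
    have hal : 0 < a * l 0 := mul_pos ha0 (hl0 0)
    have hg1 : (γ 0)⁻¹ ≤ (a * l 0)⁻¹ := inv_anti₀ hal hgap
    have hg2 : (γ 0 ^ 2)⁻¹ ≤ (a ^ 2 * l 0 ^ 2)⁻¹ := by
      rw [← mul_pow]
      exact inv_anti₀ (pow_pos hal 2) (pow_le_pow_left₀ hal.le hgap 2)
    have hlast : 0 < (l (Fin.last k))⁻¹ := inv_pos.2 (hl0 _)
    have hlast2 : 0 < (l (Fin.last k) ^ 2)⁻¹ := inv_pos.2 (pow_pos (hl0 _) 2)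
    rw [m1, m2, m3, m4]
    refine ⟨hb1.1, rfl, ?_, hb2.1, ?_, hb3.1, ?_⟩
    · rw [div_eq_mul_inv]
      linarith [hb1.2, inv_pos.2 hal]
    · have hs : (l 0 ^ 2)⁻¹ ≤ ∑ j, (l j ^ 2)⁻¹ :=
        Finset.single_le_sum (f := fun j => (l j ^ 2)⁻¹)
          (fun j _ => inv_nonneg.2 (sq_nonneg _)) (Finset.mem_univ 0)
      have hs0 : 0 < ∑ j, (l j ^ 2)⁻¹ := (inv_pos.2 (pow_pos (hl0 0) 2)).trans_le hs
      have ha2 : 1 ≤ (a ^ 2)⁻¹ := (one_le_inv₀ (pow_pos ha0 2)).2 (pow_le_one₀ ha0.le ha1)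
      rw [mul_inv] at hg2
      rw [div_eq_mul_inv]
      nlinarith [hb2.2, mul_le_mul_of_nonneg_left hs (zero_le_one.trans ha2)]
    · have h2 : (2 : ℝ)⁻¹ ≤ (γ 0)⁻¹ := inv_anti₀ (hγ0 0) ((hγle 0).trans (hl2 0))
      have h3 : -(1 / 4) ≤ (l (Fin.last k) ^ 2)⁻¹ - (l (Fin.last k))⁻¹ := by
        rw [← inv_pow]
        nlinarith [sq_nonneg ((l (Fin.last k))⁻¹ - 1 / 2)]
      have h4 : 0 < (a ^ 2 * l 0 ^ 2)⁻¹ := inv_pos.2 (by rw [← mul_pow]; exact pow_pos hal 2)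
      rw [div_eq_mul_inv]
      linarith [hb3.2]

end
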